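/- Let b ≥ 4 be an integer base. If b is even, then the least u ∈ ℕ with F(u) = 3 and u ≡ 0 (mod b−1) equals K_0(3) = b^{b+3} + b² + 2b − 4, and for each λ with 0 ≤ λ ≤ b−3, the least u ∈ ℕ with F(u) = 3 and u ≡ 2 + 2λ (mod b−1) equals K_{2+2λ}(3) = b^{b+3} + 1 + 2λ. If b ≥ 5 is odd, then K_0(3) = b² + 2b − 3, and for each λ with 0 ≤ λ ≤ (b−5)/2, K_{2+2λ}(3) = b² + 1 + 2λ. -/

import Mathlib

namespace Kaprekar

/-- Sum of the digits of `v` in base `b`. -/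
def s (b v : ℕ) : ℕ := (Nat.digits b v).sum

/-- `f v = v + s v`. -/
def f (b v : ℕ) : ℕ := v + s b v

/-- `F u` is the number of generators of `u`. -/
noncomputable def F (b u : ℕ) : ℕ := Set.ncard {v : ℕ | f b v = u}

theorem s_mul_add (b x y : ℕ) (hb : 2 ≤ b) (hy : y < b) : s b (b * x + y) = s b x + y := by
  rcases Nat.eq_zero_or_pos (b * x + y) with h | h
  · have hy0 : y = 0 := by omega
    have hx0 : x = 0 := by
      have : b * x = 0 := by omega
      rcases Nat.mul_eq_zero.mp this with h | h <;> omega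
    simp [s, hx0, hy0]
  · unfold s
    rw [Nat.digits_def' (by omega) h, List.sum_cons, Nat.mul_add_mod, Nat.mod_eq_of_lt hy,
      Nat.mul_add_div (by omega), Nat.div_eq_of_lt hy]
    simp [add_comm]

theorem s_of_lt (b y : ℕ) (hb : 2 ≤ b) (hy : y < b) : s b y = y := by
  simpa [s] using s_mul_add b 0 y hb hy

theorem s_mul_pow_add (b a k : ℕ) (hb : 2 ≤ b) :
    ∀ w < b ^ k, s b (a * b ^ k + w) = s b a + s b w := by
  induction k with
  | zero =>
    intro w hw
    have : w = 0 := by simpa using hw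
    simp [this, s]
  | succ k ih =>
    intro w hw
    have hlt : w / b < b ^ k := Nat.div_lt_of_lt_mul (by rwa [pow_succ'] at hw)
    have hmod : w % b < b := Nat.mod_lt _ (by omega)
    have hdiv := Nat.div_add_mod w b
    have e : a * b ^ (k + 1) + w = b * (a * b ^ k + w / b) + w % b := by
      conv_lhs => rw [← hdiv]
      ring
    have e' := s_mul_add b (w / b) (w % b) hb hmod
    rw [hdiv] at e'
    rw [e, s_mul_add _ _ _ hb hmod, ih _ hlt, e']
    ring

theorem s_complement (b k : ℕ) (hb : 2 ≤ b) :
    ∀ v w, v + w + 1 = b ^ k → s b v + s b w = k * (b - 1) := by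
  induction k with
  | zero =>
    intro v w h
    have : v = 0 ∧ w = 0 := by simp at h; omega
    simp [this.1, this.2, s]
  | succ k ih =>
    intro v w h
    have hv := Nat.div_add_mod v b
    have hw := Nat.div_add_mod w b
    have hvm : v % b < b := Nat.mod_lt _ (by omega)
    have hwm : w % b < b := Nat.mod_lt _ (by omega)
    have ev := s_mul_add b (v / b) (v % b) hb hvm
    have ew := s_mul_add b (w / b) (w % b) hb hwm
    rw [hv] at ev
    rw [hw] at ew
    have key : b * (v / b + w / b) + (v % b + w % b + 1) = b * b ^ k := by
      rw [← pow_succ', ← h, mul_add]; omega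
    have hd : b ∣ v % b + w % b + 1 :=
      (Nat.dvd_add_right (dvd_mul_right b _)).mp (key ▸ dvd_mul_right b _)
    have hs : v % b + w % b + 1 = b := by
      obtain ⟨c, hc⟩ := hd
      have h1 : c < 2 := by
        by_contra hcon
        have : b * 2 ≤ b * c := Nat.mul_le_mul_left b (by omega)
        omega
      have h0 : c ≠ 0 := by rintro rfl; omega
      have : c = 1 := by omega
      simpa [this] using hc
    have hq : v / b + w / b + 1 = b ^ k := by
      rw [hs] at key
      exact Nat.eq_of_mul_eq_mul_left (by omega : 0 < b) (by rw [← key]; ring)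
    have := ih _ _ hq
    rw [ev, ew, Nat.succ_mul]
    omega

theorem s_le_of_lt_pow (b k v : ℕ) (hb : 2 ≤ b) (hv : v < b ^ k) : s b v ≤ k * (b - 1) := by
  have := s_complement b k hb v (b ^ k - 1 - v) (by omega)
  omega

theorem le_f (b v : ℕ) : v ≤ f b v := Nat.le_add_right _ _

theorem f_of_lt (b v : ℕ) (hb : 2 ≤ b) (hv : v < b) : f b v = 2 * v := by
  rw [f, s_of_lt b v hb hv]; ring

theorem f_two_digits (b x y : ℕ) (hb : 2 ≤ b) (hx : x < b) (hy : y < b) :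
    f b (b * x + y) = (b + 1) * x + 2 * y := by
  rw [f, s_mul_add b x y hb hy, s_of_lt b x hb hx]; ring

theorem f_mul_pow_add (b a k w : ℕ) (hb : 2 ≤ b) (ha : a < b) (hw : w < b ^ k) :
    f b (a * b ^ k + w) = a * b ^ k + a + f b w := by
  rw [f, s_mul_pow_add b a k hb w hw, s_of_lt b a hb ha, f]; ring

theorem f_complement (b k v w : ℕ) (hb : 2 ≤ b) (h : v + w + 1 = b ^ k) :
    f b v + f b w + 1 = b ^ k + k * (b - 1) := by
  have := s_complement b k hb v w h
  simp only [f]; omega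

theorem generators_finite (b u : ℕ) : {v : ℕ | f b v = u}.Finite :=
  (Set.finite_Iic u).subset fun v hv => by
    rw [Set.mem_ofPred_eq] at hv
    exact hv ▸ le_f b v

theorem F_pos_iff (b u : ℕ) : 0 < F b u ↔ ∃ v, f b v = u := by
  rw [F, Set.ncard_pos (generators_finite b u)]; rfl

theorem mul_add_le_pow (b k : ℕ) (hb : 4 ≤ b) (hk : 2 ≤ k) : k * (b - 1) + b ≤ b ^ k := by
  obtain ⟨c, rfl⟩ : ∃ c, b = c + 1 := ⟨b - 1, by omega⟩
  simp only [Nat.add_sub_cancel]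
  induction k, hk using Nat.le_induction with
  | base => nlinarith
  | succ k hk ih =>
    have : 1 ≤ (c + 1) ^ k := Nat.one_le_pow _ _ (by omega)
    calc (k + 1) * c + (c + 1) = (k * c + (c + 1)) + c * 1 := by ring
      _ ≤ (c + 1) ^ k + c * (c + 1) ^ k := by gcongr
      _ = (c + 1) ^ (k + 1) := by ring

/-- The generators of `a * b ^ k + t` have leading part `a` or `a - 1`. -/
theorem generators_eq_union (b a k t : ℕ) (hb : 4 ≤ b) (hk : 2 ≤ k) (ha : 1 ≤ a) (hab : a < b)
    (ht : t < b ^ k) :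
    {v : ℕ | f b v = a * b ^ k + t} =
      (fun w => a * b ^ k + w) '' {w | f b w + a = t} ∪
      (fun w => a * b ^ k - 1 - w) '' {w | f b w + t + 2 = k * (b - 1) + a} := by
  have hpow := mul_add_le_pow b k hb hk
  obtain ⟨a, rfl⟩ : ∃ c, a = c + 1 := ⟨a - 1, by omega⟩
  ext v
  simp only [Set.mem_ofPred_eq, Set.mem_union, Set.mem_image]
  constructor
  · intro hv
    have hle := le_f b v
    have hdiv := Nat.div_add_mod' v (b ^ k)
    have hmod : v % b ^ k < b ^ k := Nat.mod_lt _ (by omega)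
    generalize v / b ^ k = x at hdiv
    generalize v % b ^ k = w at hdiv hmod
    subst hdiv
    have hx : x < a + 2 := by
      by_contra hcon
      have := Nat.mul_le_mul_right (b ^ k) (not_lt.mp hcon)
      simp only [add_mul] at this hv hle
      omega
    have hf := f_mul_pow_add b x k w (by omega) (by omega) hmod
    have hs := s_le_of_lt_pow b k w (by omega) hmod
    have hfw : f b w = w + s b w := rfl
    rcases lt_trichotomy x a with h | h | h
    · exfalso
      have := Nat.mul_le_mul_right (b ^ k) (show x + 1 ≤ a by omega)
      simp only [add_mul] at this hv
      omega
    · right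
      subst h
      have hc := f_complement b k w (b ^ k - 1 - w) (by omega) (by omega)
      refine ⟨b ^ k - 1 - w, ?_, ?_⟩
      · simp only [add_mul] at hv; omega
      · simp only [add_mul]; omega
    · left
      have : x = a + 1 := by omega
      subst this
      exact ⟨w, by omega, rfl⟩
  · rintro (⟨w, hw, rfl⟩ | ⟨w, hw, rfl⟩)
    · have := le_f b w
      rw [f_mul_pow_add b (a + 1) k w (by omega) hab (by omega)]
      omega
    · have := le_f b w
      have hc := f_complement b k (b ^ k - 1 - w) w (by omega) (by omega)
      have e : (a + 1) * b ^ k - 1 - w = a * b ^ k + (b ^ k - 1 - w) := by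
        simp only [add_mul]; omega
      rw [e, f_mul_pow_add b a k _ (by omega) (by omega) (by omega)]
      simp only [add_mul]; omega

theorem F_mul_pow_add (b a k t : ℕ) (hb : 4 ≤ b) (hk : 2 ≤ k) (ha : 1 ≤ a) (hab : a < b)
    (ht : t < b ^ k) :
    F b (a * b ^ k + t) = {w | f b w + a = t}.ncard +
      {w | f b w + t + 2 = k * (b - 1) + a}.ncard := by
  have hpow := mul_add_le_pow b k hb hk
  have hak : b ^ k ≤ a * b ^ k := Nat.le_mul_of_pos_left _ ha
  have hU := generators_eq_union b a k t hb hk ha hab ht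
  have hfin := generators_finite b (a * b ^ k + t)
  rw [hU] at hfin
  have hfin₁ := hfin.subset Set.subset_union_left
  have hfin₂ := hfin.subset Set.subset_union_right
  rw [F, hU, Set.ncard_union_eq _ hfin₁ hfin₂, Set.InjOn.ncard_image, Set.InjOn.ncard_image]
  · intro x hx y hy hxy
    have := le_f b x
    have := le_f b y
    simp only [Set.mem_ofPred_eq] at hx hy hxy
    omega
  · intro x _ y _ hxy
    simpa using hxy
  · rw [Set.disjoint_left]
    rintro _ ⟨x, -, rfl⟩ ⟨y, -, hy⟩
    simp only at hy
    omega

theorem ncard_f_add (b a c : ℕ) (h : a ≤ c) : {w | f b w + a = c}.ncard = F b (c - a) := by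
  rw [F]; congr 1; ext w; simp only [Set.mem_ofPred_eq]; omega

theorem ncard_f_add_of_lt (b a c : ℕ) (h : c < a) : {w | f b w + a = c}.ncard = 0 := by
  have : {w | f b w + a = c} = ∅ := by
    ext w; simp only [Set.mem_ofPred_eq, Set.mem_empty_iff_false, iff_false]; omega
  rw [this, Set.ncard_empty]

theorem F_mul_pow_add_eq_add (b a k p q : ℕ) (hb : 4 ≤ b) (hk : 2 ≤ k) (ha : 1 ≤ a) (hab : a < b)
    (hp : a + p < b ^ k) (hpq : p + q + 2 = k * (b - 1)) :
    F b (a * b ^ k + (a + p)) = F b p + F b q := by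
  rw [F_mul_pow_add b a k _ hb hk ha hab hp, ncard_f_add b a _ (by omega)]
  have := ncard_f_add b (a + p + 2) (k * (b - 1) + a) (by omega)
  simp only [← add_assoc] at this ⊢
  rw [this]
  congr 2 <;> omega

theorem F_mul_pow_add_cases (b a k t : ℕ) (hb : 4 ≤ b) (hk : 2 ≤ k) (ha : 1 ≤ a) (hab : a < b)
    (ht : t < b ^ k) :
    (∃ p q, t = a + p ∧ p + q + 2 = k * (b - 1) ∧ F b (a * b ^ k + t) = F b p + F b q) ∨
      ∃ r < b ^ k, F b (a * b ^ k + t) = F b r := by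
  have hpow := mul_add_le_pow b k hb hk
  have hbk : 2 ≤ k * (b - 1) := by nlinarith [show 3 ≤ b - 1 by omega]
  by_cases h₁ : t < a
  · right
    refine ⟨k * (b - 1) + a - (t + 2), by omega, ?_⟩
    rw [F_mul_pow_add b a k t hb hk ha hab ht, ncard_f_add_of_lt _ _ _ h₁, zero_add,
      ← ncard_f_add b (t + 2) _ (by omega)]
    simp only [add_assoc]
  by_cases h₂ : k * (b - 1) + a < t + 2
  · right
    refine ⟨t - a, by omega, ?_⟩
    have := ncard_f_add_of_lt b (t + 2) (k * (b - 1) + a) h₂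
    simp only [← add_assoc] at this
    rw [F_mul_pow_add b a k t hb hk ha hab ht, this, add_zero, ncard_f_add b a t (by omega)]
  left
  refine ⟨t - a, k * (b - 1) + a - (t + 2), by omega, by omega, ?_⟩
  have := F_mul_pow_add_eq_add b a k (t - a) (k * (b - 1) + a - (t + 2)) hb hk ha hab
    (by omega) (by omega)
  rwa [show a + (t - a) = t by omega] at this

theorem f_eq_of_lt_sq (b v : ℕ) (hb : 2 ≤ b) (hv : v < b ^ 2) :
    f b v = (b + 1) * (v / b) + 2 * (v % b) := by
  have hx : v / b < b := Nat.div_lt_of_lt_mul (by rwa [sq] at hv)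
  have := f_two_digits b (v / b) (v % b) hb hx (Nat.mod_lt _ (by omega))
  rwa [Nat.div_add_mod] at this

theorem div_le_of_f_eq (b v w : ℕ) (hb : 2 ≤ b) (hv : v < b ^ 2) (hw : w < b ^ 2)
    (h : f b v = f b w) : v / b ≤ w / b + 1 := by
  rw [f_eq_of_lt_sq b v hb hv, f_eq_of_lt_sq b w hb hw] at h
  have hm := Nat.mod_lt w (show b > 0 by omega)
  by_contra hcon
  have := Nat.mul_le_mul_left (b + 1) (show w / b + 2 ≤ v / b by omega)
  rw [mul_add] at this
  omega

theorem eq_of_f_eq_of_div_eq (b v w : ℕ) (hb : 2 ≤ b) (hv : v < b ^ 2) (hw : w < b ^ 2)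
    (h : f b v = f b w) (hd : v / b = w / b) : v = w := by
  rw [f_eq_of_lt_sq b v hb hv, f_eq_of_lt_sq b w hb hw, hd] at h
  rw [← Nat.div_add_mod v b, ← Nat.div_add_mod w b, hd]
  omega

theorem eq_of_f_eq_of_parity (b v w : ℕ) (hb : 2 ≤ b) (hv : v < b ^ 2) (hw : w < b ^ 2)
    (h : f b v = f b w) (hd : v / b % 2 = w / b % 2) : v = w := by
  have h₁ := div_le_of_f_eq b v w hb hv hw h
  have h₂ := div_le_of_f_eq b w v hb hw hv h.symm
  exact eq_of_f_eq_of_div_eq b v w hb hv hw h (by omega)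

theorem F_le_two_of_lt_sq (b u : ℕ) (hb : 2 ≤ b) (hu : u < b ^ 2) : F b u ≤ 2 := by
  have h := Set.ncard_le_ncard_of_injOn (s := {v : ℕ | f b v = u}) (t := Set.Iio 2)
    (fun v => v / b % 2) (fun v _ => Nat.mod_lt _ (by omega))
    (fun v hv w hw hvw => by
      simp only [Set.mem_ofPred_eq] at hv hw
      have := le_f b v
      have := le_f b w
      exact eq_of_f_eq_of_parity b v w hb (by omega) (by omega) (by omega) hvw)
    (Set.finite_Iio 2)
  have h2 : (Set.Iio 2 : Set ℕ).ncard = 2 := by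
    rw [← Finset.coe_Iio, Set.ncard_coe_finset]; rfl
  rw [h2] at h
  exact h

theorem F_le_one_of_lt_sq (b u : ℕ) (hb : 2 ≤ b) (he : Even b) (hu : u < b ^ 2) :
    F b u ≤ 1 := by
  rw [F, Set.ncard_le_one (generators_finite b u)]
  intro v hv w hw
  simp only [Set.mem_ofPred_eq] at hv hw
  have := le_f b v
  have := le_f b w
  refine eq_of_f_eq_of_parity b v w hb (by omega) (by omega) (by omega) ?_
  have e := hv.trans hw.symm
  rw [f_eq_of_lt_sq b v hb (by omega), f_eq_of_lt_sq b w hb (by omega)] at e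
  obtain ⟨c, rfl⟩ := he
  generalize v / (c + c) = x at *
  generalize w / (c + c) = y at *
  have e' := congrArg (· % 2) e
  have hx : (c + c + 1) * x = 2 * (c * x) + x := by ring
  have hy : (c + c + 1) * y = 2 * (c * y) + y := by ring
  simp only [hx, hy] at e'
  omega

theorem F_two_mul_of_lt (b y : ℕ) (hb : 2 ≤ b) (hy : 2 * y < b) : F b (2 * y) = 1 := by
  rw [F, Set.ncard_eq_one]
  refine ⟨y, ?_⟩
  ext v
  simp only [Set.mem_ofPred_eq, Set.mem_singleton_iff]
  constructor
  · intro hv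
    have := le_f b v
    rw [f_of_lt b v hb (by omega)] at hv
    omega
  · rintro rfl
    exact f_of_lt b v hb (by omega)

theorem even_of_F_pos_of_lt (b u : ℕ) (hb : 2 ≤ b) (hu : u < b) (h : 0 < F b u) : u % 2 = 0 := by
  obtain ⟨v, hv⟩ := (F_pos_iff b u).mp h
  have := le_f b v
  rw [f_of_lt b v hb (by omega)] at hv
  omega

theorem F_two_mul_of_even (b y : ℕ) (hb : 4 ≤ b) (he : Even b) (hy : y < b) :
    F b (2 * y) = 1 := by
  have h₁ : 0 < F b (2 * y) := (F_pos_iff b _).mpr ⟨y, f_of_lt b y (by omega) hy⟩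
  have h₂ := F_le_one_of_lt_sq b (2 * y) (by omega) he (by nlinarith)
  omega

theorem F_sq_add_odd (b j : ℕ) (hb : 4 ≤ b) (he : Even b) (hj : j + 2 ≤ b) :
    F b (b ^ 2 + 1 + 2 * j) = 2 := by
  have h := F_mul_pow_add_eq_add b 1 2 (2 * j) (2 * (b - 2 - j)) hb le_rfl le_rfl (by omega)
    (by nlinarith) (by omega)
  rw [F_two_mul_of_even b j hb he (by omega), F_two_mul_of_even b _ hb he (by omega)] at h
  rw [show b ^ 2 + 1 + 2 * j = 1 * b ^ 2 + (1 + 2 * j) by ring, h]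

theorem ge_and_odd_of_two_le_F (b u : ℕ) (hb : 4 ≤ b) (he : Even b) (hu : u ≤ b ^ 2 + 2 * b)
    (h : 2 ≤ F b u) : b ^ 2 + 1 ≤ u ∧ u % 2 = 1 := by
  have hsq : 4 * b ≤ b ^ 2 := by nlinarith
  have hbe : b ^ 2 % 2 = 0 := Nat.even_iff.mp (he.pow_of_ne_zero two_ne_zero)
  have hge : b ^ 2 ≤ u := by
    by_contra hcon
    have := F_le_one_of_lt_sq b u (by omega) he (by omega)
    omega
  obtain ⟨t, rfl⟩ := Nat.exists_eq_add_of_le hge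
  have hc := F_mul_pow_add_cases b 1 2 t hb le_rfl le_rfl (by omega) (by omega)
  rw [one_mul] at hc
  rcases hc with ⟨p, q, hp, hpq, hF⟩ | ⟨r, hr, hF⟩
  · have hp1 := F_le_one_of_lt_sq b p (by omega) he (by omega)
    have hq1 := F_le_one_of_lt_sq b q (by omega) he (by omega)
    refine ⟨by omega, ?_⟩
    rcases Nat.lt_or_ge p b with h' | h'
    · have := even_of_F_pos_of_lt b p (by omega) h' (by omega)
      omega
    · have := even_of_F_pos_of_lt b q (by omega) (by omega) (by omega)
      omega
  · have := F_le_one_of_lt_sq b r (by omega) he hr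
    omega

theorem exists_leading_digit (b u : ℕ) (hb : 2 ≤ b) (hu : u ≠ 0) :
    ∃ a k t, 1 ≤ a ∧ a < b ∧ t < b ^ k ∧ u = a * b ^ k + t := by
  have hpos : 0 < b ^ Nat.log b u := Nat.pow_pos (by omega)
  refine ⟨u / b ^ Nat.log b u, Nat.log b u, u % b ^ Nat.log b u, ?_, ?_, Nat.mod_lt _ hpos,
    (Nat.div_add_mod' _ _).symm⟩
  · exact Nat.div_pos (Nat.pow_log_le_self b hu) hpos
  · apply Nat.div_lt_of_lt_mul
    rw [← pow_succ]
    exact Nat.lt_pow_succ_log_self (by omega) u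

theorem F_le_two_of_lt_pow (b : ℕ) (hb : 4 ≤ b) (he : Even b) :
    ∀ u < b ^ (b + 3), F b u ≤ 2 := by
  intro u
  induction u using Nat.strong_induction_on with
  | _ u ih =>
    intro hu
    by_cases hsmall : u < b ^ 2
    · exact F_le_two_of_lt_sq b u (by omega) hsmall
    have hsq : 4 * b ≤ b ^ 2 := by nlinarith
    obtain ⟨a, k, t, ha, hab, ht, rfl⟩ := exists_leading_digit b u (by omega) (by omega)
    have hak : b ^ k ≤ a * b ^ k := Nat.le_mul_of_pos_left _ ha
    have hk3 : k < b + 3 := (Nat.pow_lt_pow_iff_right (by omega : 1 < b)).mp (by omega)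
    have hk2 : 2 ≤ k := by
      by_contra hcon
      apply hsmall
      calc a * b ^ k + t < a * b ^ k + b ^ k := by omega
        _ = (a + 1) * b ^ k := by ring
        _ ≤ b * b ^ 1 := Nat.mul_le_mul (by omega) (Nat.pow_le_pow_right (by omega) (by omega))
        _ = b ^ 2 := by ring
    have hpow := mul_add_le_pow b k hb hk2
    rcases F_mul_pow_add_cases b a k t hb hk2 ha hab ht with
      ⟨p, q, hp, hpq, hF⟩ | ⟨r, hr, hF⟩
    · have hp2 := ih p (by omega) (by omega)
      have hq2 := ih q (by omega) (by omega)
      have hkey : p + q ≤ b ^ 2 + b ∧ (b ^ 2 - 3 ≤ p + q → (p + q) % 2 = 0 ∧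
          p + q + 4 = b ^ 2 + b ∨ p + q + 3 = b ^ 2) := by
        have e₁ : (b + 2) * (b - 1) + 2 = b ^ 2 + b := by
          obtain ⟨c, rfl⟩ : ∃ c, b = c + 1 := ⟨b - 1, by omega⟩
          simp only [Nat.add_sub_cancel]; ring
        have e₂ : (b + 1) * (b - 1) + 1 = b ^ 2 := by
          obtain ⟨c, rfl⟩ : ∃ c, b = c + 1 := ⟨b - 1, by omega⟩
          simp only [Nat.add_sub_cancel]; ring
        have hbe : b ^ 2 % 2 = 0 := Nat.even_iff.mp (he.pow_of_ne_zero two_ne_zero)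
        have hb2 : b % 2 = 0 := Nat.even_iff.mp he
        rcases Nat.lt_or_ge k (b + 2) with h | h
        · have := Nat.mul_le_mul_right (b - 1) (show k ≤ b + 1 by omega)
          omega
        · have : k = b + 2 := by omega
          subst this
          omega
      by_contra hcon
      rcases Nat.lt_or_ge (F b p) 2 with h | h
      · have h₁ := ge_and_odd_of_two_le_F b q hb he (by omega) (by omega)
        have h₂ := even_of_F_pos_of_lt b p (by omega) (by omega) (by omega)
        omega
      · have h₁ := ge_and_odd_of_two_le_F b p hb he (by omega) (by omega)
        have h₂ := even_of_F_pos_of_lt b q (by omega) (by omega) (by omega)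
        omega
    · rw [hF]
      exact ih r (by omega) (by omega)

theorem cast_pow_eq_one (b k : ℕ) (hb : 1 ≤ b) : ((b ^ k : ℕ) : ZMod (b - 1)) = 1 := by
  obtain ⟨c, rfl⟩ : ∃ c, b = c + 1 := ⟨b - 1, by omega⟩
  simp

theorem cast_self_eq_one (b : ℕ) (hb : 1 ≤ b) : ((b : ℕ) : ZMod (b - 1)) = 1 := by
  simpa using cast_pow_eq_one b 1 hb

/-- If `u ≤ m` have the same residue modulo `b - 1`, they differ by a multiple of `b - 1`. -/
theorem exists_mul_of_cast_eq (b u m : ℕ) (h : (u : ZMod (b - 1)) = (m : ZMod (b - 1)))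
    (hum : u < m) : ∃ j, 1 ≤ j ∧ m = u + (b - 1) * j := by
  rw [ZMod.natCast_eq_natCast_iff, Nat.modEq_iff_dvd' hum.le] at h
  obtain ⟨j, hj⟩ := h
  refine ⟨j, Nat.pos_of_ne_zero ?_, by omega⟩
  rintro rfl
  simp at hj
  omega

theorem add_three_mul (b : ℕ) (hb : 1 ≤ b) : (b + 3) * (b - 1) + 3 = b ^ 2 + 2 * b := by
  obtain ⟨c, rfl⟩ : ∃ c, b = c + 1 := ⟨b - 1, by omega⟩
  simp only [Nat.add_sub_cancel]; ring

theorem F_pow_add_odd (b lam : ℕ) (hb : 4 ≤ b) (he : Even b) (hl : lam ≤ b - 3) :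
    F b (b ^ (b + 3) + 1 + 2 * lam) = 3 := by
  have hpow := mul_add_le_pow b (b + 3) hb (by omega)
  have e := add_three_mul b (by omega)
  have hsq : 4 * b ≤ b ^ 2 := by nlinarith
  have h := F_mul_pow_add_eq_add b 1 (b + 3) (2 * lam) (b ^ 2 + 1 + 2 * (b - 3 - lam)) hb
    (by omega) le_rfl (by omega) (by omega) (by omega)
  rw [F_two_mul_of_even b lam hb he (by omega), F_sq_add_odd b _ hb he (by omega)] at h
  rw [show b ^ (b + 3) + 1 + 2 * lam = 1 * b ^ (b + 3) + (1 + 2 * lam) by ring, h]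

theorem F_pow_add_sq (b : ℕ) (hb : 4 ≤ b) (he : Even b) :
    F b (b ^ (b + 3) + b ^ 2 + 2 * b - 4) = 3 := by
  have hpow := mul_add_le_pow b (b + 3) hb (by omega)
  have e := add_three_mul b (by omega)
  have hsq : 4 * b ≤ b ^ 2 := by nlinarith
  have h := F_mul_pow_add_eq_add b 1 (b + 3) (b ^ 2 + 1 + 2 * (b - 3)) (2 * 0) hb
    (by omega) le_rfl (by omega) (by omega) (by omega)
  rw [F_two_mul_of_even b 0 hb he (by omega), F_sq_add_odd b _ hb he (by omega)] at h
  rw [show b ^ (b + 3) + b ^ 2 + 2 * b - 4 =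
    1 * b ^ (b + 3) + (1 + (b ^ 2 + 1 + 2 * (b - 3))) by omega, h]

theorem isLeast_even_zero (b : ℕ) (hb : 4 ≤ b) (he : Even b) :
    IsLeast {u : ℕ | F b u = 3 ∧ (u : ZMod (b - 1)) = 0} (b ^ (b + 3) + b ^ 2 + 2 * b - 4) := by
  have hsq : 4 * b ≤ b ^ 2 := by nlinarith
  have hcast : ((b ^ (b + 3) + b ^ 2 + 2 * b - 4 : ℕ) : ZMod (b - 1)) = 0 := by
    rw [Nat.cast_sub (by omega), Nat.cast_add, Nat.cast_add, cast_pow_eq_one b _ (by omega),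
      cast_pow_eq_one b _ (by omega), Nat.cast_mul, cast_self_eq_one b (by omega)]
    push_cast; ring
  refine ⟨⟨F_pow_add_sq b hb he, hcast⟩, ?_⟩
  rintro u ⟨hF, hu⟩
  by_contra hlt
  obtain ⟨j, hj, hm⟩ := exists_mul_of_cast_eq b u _ (hu.trans hcast.symm) (not_le.mp hlt)
  have hge : b ^ (b + 3) ≤ u := by
    by_contra hcon
    have := F_le_two_of_lt_pow b hb he u (by omega)
    omega
  obtain ⟨t, rfl⟩ := Nat.exists_eq_add_of_le hge
  have hpow := mul_add_le_pow b (b + 3) hb (by omega)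
  have e := add_three_mul b (by omega)
  have hc := F_mul_pow_add_cases b 1 (b + 3) t hb (by omega) le_rfl (by omega) (by omega)
  rw [one_mul] at hc
  rcases hc with ⟨p, q, hp, hpq, hF'⟩ | ⟨r, hr, hF'⟩
  · have hq : q = (b - 1) * j := by omega
    have hb2 : b % 2 = 0 := Nat.even_iff.mp he
    have hp2 := F_le_two_of_lt_pow b hb he p (by omega)
    have hq2 := F_le_two_of_lt_pow b hb he q (by omega)
    rcases Nat.lt_or_ge (F b p) 2 with h | h
    · have h₁ := ge_and_odd_of_two_le_F b q hb he (by omega) (by omega)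
      have e' : (b - 1) * (b + 1) + 1 = b ^ 2 := by
        obtain ⟨c, rfl⟩ : ∃ c, b = c + 1 := ⟨b - 1, by omega⟩
        simp only [Nat.add_sub_cancel]; ring
      have hj₁ : b + 1 < j := by
        by_contra hcon
        have := Nat.mul_le_mul_left (b - 1) (not_lt.mp hcon)
        omega
      have hj₂ : j < b + 3 := by
        by_contra hcon
        have := Nat.mul_le_mul_left (b - 1) (not_lt.mp hcon)
        rw [mul_comm (b - 1) (b + 3)] at this
        omega
      have : j = b + 2 := by omega
      subst this
      have : q % 2 = 0 := by
        rw [hq, Nat.mul_mod, show (b + 2) % 2 = 0 by omega]; simp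
      omega
    · have h₁ := ge_and_odd_of_two_le_F b p hb he (by omega) (by omega)
      have hj₂ : j < 2 := by
        by_contra hcon
        have := Nat.mul_le_mul_left (b - 1) (not_lt.mp hcon)
        omega
      have : j = 1 := by omega
      subst this
      have := even_of_F_pos_of_lt b q (by omega) (by omega) (by omega)
      omega
  · have := F_le_two_of_lt_pow b hb he r hr
    omega

theorem isLeast_even_two_add (b lam : ℕ) (hb : 4 ≤ b) (he : Even b) (hl : lam ≤ b - 3) :
    IsLeast {u : ℕ | F b u = 3 ∧ (u : ZMod (b - 1)) = ((2 + 2 * lam : ℕ) : ZMod (b - 1))}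
      (b ^ (b + 3) + 1 + 2 * lam) := by
  have hcast : ((b ^ (b + 3) + 1 + 2 * lam : ℕ) : ZMod (b - 1)) =
      ((2 + 2 * lam : ℕ) : ZMod (b - 1)) := by
    rw [Nat.cast_add, Nat.cast_add, cast_pow_eq_one b _ (by omega)]
    push_cast; ring
  refine ⟨⟨F_pow_add_odd b lam hb he hl, hcast⟩, ?_⟩
  rintro u ⟨hF, hu⟩
  by_contra hlt
  obtain ⟨j, hj, hm⟩ := exists_mul_of_cast_eq b u _ (hu.trans hcast.symm) (not_le.mp hlt)
  have hge : b ^ (b + 3) ≤ u := by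
    by_contra hcon
    have := F_le_two_of_lt_pow b hb he u (by omega)
    omega
  obtain ⟨t, rfl⟩ := Nat.exists_eq_add_of_le hge
  have hpow := mul_add_le_pow b (b + 3) hb (by omega)
  have e := add_three_mul b (by omega)
  have hsq : 4 * b ≤ b ^ 2 := by nlinarith
  have hj₂ : j < 2 := by
    by_contra hcon
    have := Nat.mul_le_mul_left (b - 1) (not_lt.mp hcon)
    omega
  have : j = 1 := by omega
  subst this
  have hb2 : b % 2 = 0 := Nat.even_iff.mp he
  have hc := F_mul_pow_add_cases b 1 (b + 3) t hb (by omega) le_rfl (by omega) (by omega)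
  rw [one_mul] at hc
  rcases hc with ⟨p, q, hp, hpq, hF'⟩ | ⟨r, hr, hF'⟩
  · have hq2 := F_le_two_of_lt_pow b hb he q (by omega)
    have := even_of_F_pos_of_lt b p (by omega) (by omega) (by omega)
    omega
  · have := F_le_two_of_lt_pow b hb he r hr
    omega

theorem F_eq_two_of_odd (b y : ℕ) (hb : 4 ≤ b) (ho : Odd b) (hy : y < b) (hby : b < 2 * y) :
    F b (2 * y) = 2 := by
  have hle := F_le_two_of_lt_sq b (2 * y) (by omega) (by nlinarith)
  have hgt : 1 < F b (2 * y) := by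
    rw [F, Set.one_lt_ncard_iff (generators_finite b _)]
    obtain ⟨c, rfl⟩ := ho
    refine ⟨y, (2 * c + 1) * 1 + (y - c - 1), f_of_lt _ y (by omega) hy, ?_, by omega⟩
    rw [Set.mem_ofPred_eq, f_two_digits _ _ _ (by omega) (by omega) (by omega)]
    omega
  omega

theorem isLeast_odd_zero (b : ℕ) (hb : 4 ≤ b) (ho : Odd b) :
    IsLeast {u : ℕ | F b u = 3 ∧ (u : ZMod (b - 1)) = 0} (b ^ 2 + 2 * b - 3) := by
  have hsq : 4 * b ≤ b ^ 2 := by nlinarith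
  have hcast : ((b ^ 2 + 2 * b - 3 : ℕ) : ZMod (b - 1)) = 0 := by
    rw [Nat.cast_sub (by omega), Nat.cast_add,
      cast_pow_eq_one b _ (by omega), Nat.cast_mul, cast_self_eq_one b (by omega)]
    push_cast; ring
  have hb2 : b % 2 = 1 := Nat.odd_iff.mp ho
  refine ⟨⟨?_, hcast⟩, ?_⟩
  · have h := F_mul_pow_add_eq_add b 1 2 (2 * (b - 2)) (2 * 0) hb le_rfl le_rfl (by omega)
      (by omega) (by omega)
    rw [F_eq_two_of_odd b _ hb ho (by omega) (by omega),
      F_two_mul_of_lt b 0 (by omega) (by omega)] at h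
    rw [show b ^ 2 + 2 * b - 3 = 1 * b ^ 2 + (1 + 2 * (b - 2)) by omega, h]
  rintro u ⟨hF, hu⟩
  by_contra hlt
  obtain ⟨j, hj, hm⟩ := exists_mul_of_cast_eq b u _ (hu.trans hcast.symm) (not_le.mp hlt)
  have hge : b ^ 2 ≤ u := by
    by_contra hcon
    have := F_le_two_of_lt_sq b u (by omega) (by omega)
    omega
  have hj₂ : j < 2 := by
    by_contra hcon
    have := Nat.mul_le_mul_left (b - 1) (not_lt.mp hcon)
    omega
  have : j = 1 := by omega
  subst this
  have hd : 2 * (b / 2) + 1 = b := by omega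
  have h := F_mul_pow_add_eq_add b 1 2 (2 * (b / 2 - 1)) (2 * (b / 2)) hb le_rfl le_rfl (by omega)
    (by omega) (by omega)
  rw [F_two_mul_of_lt b _ (by omega) (by omega), F_two_mul_of_lt b _ (by omega) (by omega),
    show 1 * b ^ 2 + (1 + 2 * (b / 2 - 1)) = u by omega] at h
  omega

theorem isLeast_odd_two_add (b lam : ℕ) (hb : 5 ≤ b) (ho : Odd b) (hl : lam ≤ (b - 5) / 2) :
    IsLeast {u : ℕ | F b u = 3 ∧ (u : ZMod (b - 1)) = ((2 + 2 * lam : ℕ) : ZMod (b - 1))}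
      (b ^ 2 + 1 + 2 * lam) := by
  have hsq : 4 * b ≤ b ^ 2 := by nlinarith
  have hcast : ((b ^ 2 + 1 + 2 * lam : ℕ) : ZMod (b - 1)) =
      ((2 + 2 * lam : ℕ) : ZMod (b - 1)) := by
    rw [Nat.cast_add, Nat.cast_add, cast_pow_eq_one b _ (by omega)]
    push_cast; ring
  refine ⟨⟨?_, hcast⟩, ?_⟩
  · have h := F_mul_pow_add_eq_add b 1 2 (2 * lam) (2 * (b - 2 - lam)) (by omega) le_rfl le_rfl
      (by omega) (by omega) (by omega)
    rw [F_eq_two_of_odd b (b - 2 - lam) (by omega) ho (by omega) (by omega),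
      F_two_mul_of_lt b lam (by omega) (by omega)] at h
    rw [show b ^ 2 + 1 + 2 * lam = 1 * b ^ 2 + (1 + 2 * lam) by ring, h]
  rintro u ⟨hF, hu⟩
  by_contra hlt
  obtain ⟨j, hj, hm⟩ := exists_mul_of_cast_eq b u _ (hu.trans hcast.symm) (not_le.mp hlt)
  have := Nat.mul_le_mul_left (b - 1) hj
  have := F_le_two_of_lt_sq b u (by omega) (by omega)
  omega

theorem stmt12 (b : ℕ) (hb : 4 ≤ b) :
    (Even b →
      IsLeast {u : ℕ | F b u = 3 ∧ (u : ZMod (b - 1)) = 0}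
        (b ^ (b + 3) + b ^ 2 + 2 * b - 4) ∧
      ∀ lam : ℕ, lam ≤ b - 3 →
        IsLeast {u : ℕ | F b u = 3 ∧ (u : ZMod (b - 1)) = ((2 + 2 * lam : ℕ) : ZMod (b - 1))}
          (b ^ (b + 3) + 1 + 2 * lam)) ∧
    (Odd b → 5 ≤ b →
      IsLeast {u : ℕ | F b u = 3 ∧ (u : ZMod (b - 1)) = 0}
        (b ^ 2 + 2 * b - 3) ∧
      ∀ lam : ℕ, lam ≤ (b - 5) / 2 →
        IsLeast {u : ℕ | F b u = 3 ∧ (u : ZMod (b - 1)) = ((2 + 2 * lam : ℕ) : ZMod (b - 1))}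
          (b ^ 2 + 1 + 2 * lam)) := by
  refine ⟨fun he => ⟨isLeast_even_zero b hb he, fun lam hl => isLeast_even_two_add b lam hb he hl⟩,
    fun ho hb5 => ⟨isLeast_odd_zero b hb ho, fun lam hl => isLeast_odd_two_add b lam hb5 ho hl⟩⟩

end Kaprekar
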